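/- Let V_x and V_y be two disjoint sets of size n. For all sufficiently large n and every integer b with 1 ≤ b < n²/8, in the b-Waiter-Client game played on the edge set of the complete bipartite graph with parts V_x and V_y, Waiter can ensure that, with p = 1/b, Client's final bipartite graph G satisfies: G has at least n²·p/16 edges, G has at most 2·n²·p edges, and the number of paths with two edges (cherries) in G is at most 2·n³·p². -/

import Mathlib

/-!
Common definitions:
* A formal model of the `b`-Waiter-Client game on a finite board.
* Complete `H`-partite graphs `K_n^H`, canonical copies of induced subgraphs,
  canonical copies of the overlap graphs `H^J`, and the associated counting functions.
-/

namespace WCGame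

variable {X : Type*} [DecidableEq X]

/-- A history of play: the list of rounds so far, each round consisting of the
set of elements offered by Waiter together with the element chosen by Client. -/
abbrev Hist (X : Type*) := List (Finset X × X)

/-- All elements offered so far during a history. -/
def offeredSet (h : Hist X) : Finset X := h.foldr (fun r acc => r.1 ∪ acc) ∅

/-- A Waiter strategy: to every history it assigns either a set of elements to
offer next, or `none`, meaning that Waiter declares the game over. -/
abbrev WaiterStrategy (X : Type*) := Hist X → Option (Finset X)

/-- A Client strategy: to every history and currently offered set it assigns
the element of that set that Client picks. -/
abbrev ClientStrategy (X : Type*) := Hist X → Finset X → X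

/-- A Waiter strategy is legal (for board `board` and parameter `b`) if every
set it offers consists of exactly `b` elements of the board which were not
offered in any previous round.  (Waiter may always stop instead, in particular
when fewer than `b` unoffered elements remain no legal offer exists and a legal
Waiter strategy must stop.) -/
def WaiterLegal (board : Finset X) (b : ℕ) (W : WaiterStrategy X) : Prop :=
  ∀ h O, W h = some O → O.card = b ∧ O ⊆ board ∧ Disjoint O (offeredSet h)

/-- A Client strategy is legal if it always picks an element of the offered set. -/
def ClientLegal (C : ClientStrategy X) : Prop :=
  ∀ h O, O.Nonempty → C h O ∈ O

/-- Playing the game for at most `fuel` further rounds from a given history. -/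
def playAux (W : WaiterStrategy X) (C : ClientStrategy X) : ℕ → Hist X → Hist X
  | 0, h => h
  | fuel + 1, h =>
    match W h with
    | none => h
    | some O => playAux W C fuel (h ++ [(O, C h O)])

/-- Client's final set `S`: the set of all elements chosen by Client during the
whole game.  (For a legal Waiter strategy with `b ≥ 1` the game lasts at most
`board.card` rounds, so the fuel `board.card` never truncates the game.) -/
def finalSet (board : Finset X) (W : WaiterStrategy X) (C : ClientStrategy X) : Finset X :=
  ((playAux W C board.card []).map Prod.snd).toFinset

/-- Waiter can ensure that Client's final set has property `P` in the
`b`-Waiter-Client game on `board`. -/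
def WaiterCanEnsure (board : Finset X) (b : ℕ) (P : Finset X → Prop) : Prop :=
  ∃ W : WaiterStrategy X, WaiterLegal board b W ∧
    ∀ C : ClientStrategy X, ClientLegal C → P (finalSet board W C)

end WCGame

namespace GraphDefs

variable {α : Type*} [Fintype α] [DecidableEq α]

/-- The maximum density `m(H) = max { e(H')/v(H') : H' ⊆ H, v(H') ≥ 1 }`. -/
noncomputable def maxDensity (H : SimpleGraph α) : ℝ :=
  sSup { d : ℝ | ∃ H' : H.Subgraph, H'.verts.Nonempty ∧
          d = (H'.edgeSet.ncard : ℝ) / (H'.verts.ncard : ℝ) }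

/-- The complete `H`-partite graph `K_n^H`: the part `V_a` corresponding to a
vertex `a` of `H` is `{a} × Fin n`, and `(a,i)` is adjacent to `(b,j)` iff
`a` and `b` are adjacent in `H`. -/
def Kpart (H : SimpleGraph α) (n : ℕ) : SimpleGraph (α × Fin n) :=
  SimpleGraph.comap Prod.fst H

/-- Number of edges of the induced subgraph `H[s]`, i.e. edges of `H` with both
endpoints in `s`. -/
noncomputable def eIn (H : SimpleGraph α) (s : Set α) : ℕ :=
  {e ∈ H.edgeSet | ∀ v ∈ e, v ∈ s}.ncard

/-- Canonical copies of the induced subgraph `H[s]` in `G ⊆ K_n^H`.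
A canonical copy is an (automatically injective) edge-preserving map
`a ↦ (a, f a)` sending each vertex `a ∈ s` into its part `V_a`; it is thus
faithfully encoded by the function `f : s → Fin n` of second coordinates. -/
def canonCopies (H : SimpleGraph α) (n : ℕ) (G : SimpleGraph (α × Fin n)) (s : Set α) :
    Set (s → Fin n) :=
  { f | ∀ a b : s, H.Adj a b → G.Adj ((a : α), f a) ((b : α), f b) }

/-- `N_G(H[s])`: the number of canonical copies of the induced subgraph `H[s]` in `G`. -/
noncomputable def NCopies (H : SimpleGraph α) (n : ℕ) (G : SimpleGraph (α × Fin n))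
    (s : Set α) : ℕ :=
  (canonCopies H n G s).ncard

/-- The canonical copy encoded by `f` contains the vertex `(x, u)` of `K_n^H`. -/
def containsVtx {n : ℕ} (s : Set α) (f : s → Fin n) (x : α) (u : Fin n) : Prop :=
  ∃ a : s, (a : α) = x ∧ f a = u

/-- `deg_G(v, H[s])` for the pair of vertices `v = ((x,u),(y,w))`: the number of
canonical copies of `H[s]` in `G` containing both vertices. -/
noncomputable def degPair (H : SimpleGraph α) (n : ℕ) (G : SimpleGraph (α × Fin n)) (s : Set α)
    (x : α) (u : Fin n) (y : α) (w : Fin n) : ℕ :=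
  {f ∈ canonCopies H n G s | containsVtx s f x u ∧ containsVtx s f y w}.ncard

/-- Canonical copies of `H^J` (`J = H[s]`) in `G ⊆ K_n^H`.  A canonical copy of
`H^J` is faithfully encoded by the pair `(f, f')` of (second coordinates of)
canonical copies of `H` given by its restrictions to the two overlapping copies
of `H`; injectivity is equivalent to `f` and `f'` agreeing exactly on `s`. -/
def overlapCopies (H : SimpleGraph α) (n : ℕ) (G : SimpleGraph (α × Fin n)) (s : Set α) :
    Set ((α → Fin n) × (α → Fin n)) :=
  { ff | (∀ a b : α, H.Adj a b → G.Adj (a, ff.1 a) (b, ff.1 b)) ∧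
         (∀ a b : α, H.Adj a b → G.Adj (a, ff.2 a) (b, ff.2 b)) ∧
         (∀ a ∈ s, ff.1 a = ff.2 a) ∧ (∀ a ∉ s, ff.1 a ≠ ff.2 a) }

/-- `N_G(H^J)` for `J = H[s]`: the number of canonical copies of `H^J` in `G`. -/
noncomputable def NOverlap (H : SimpleGraph α) (n : ℕ) (G : SimpleGraph (α × Fin n))
    (s : Set α) : ℕ :=
  (overlapCopies H n G s).ncard

/-- `deg_G(v, H^J)` for the pair of vertices `v = ((x,u),(y,w))`: the number of
canonical copies of `H^J` in `G` containing both vertices. -/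
noncomputable def degPairOverlap (H : SimpleGraph α) (n : ℕ) (G : SimpleGraph (α × Fin n))
    (s : Set α) (x : α) (u : Fin n) (y : α) (w : Fin n) : ℕ :=
  {ff ∈ overlapCopies H n G s | (ff.1 x = u ∨ ff.2 x = u) ∧ (ff.1 y = w ∨ ff.2 y = w)}.ncard

/-- The graph obtained from `Ge` by adding, for each pair `(u,w) ∈ R`, the edge
between `(x,u) ∈ V_x` and `(y,w) ∈ V_y`. -/
def addPairs {n : ℕ} (Ge : SimpleGraph (α × Fin n)) (x y : α)
    (R : Set (Fin n × Fin n)) : SimpleGraph (α × Fin n) :=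
  Ge ⊔ SimpleGraph.fromEdgeSet { p : Sym2 (α × Fin n) | ∃ r ∈ R, p = s((x, r.1), (y, r.2)) }

/-- The edge set of a graph on a finite vertex type, as a finset (the board of
the Waiter-Client game played on the edges of this graph). -/
noncomputable def edgeBoard {β : Type*} (G : SimpleGraph β) [Finite β] : Finset (Sym2 β) :=
  (Set.toFinite G.edgeSet).toFinset

/-- The number of subgraphs of `G` isomorphic to `H`. -/
noncomputable def copyCount {β : Type*} (G : SimpleGraph β) (H : SimpleGraph α) : ℕ :=
  Set.ncard { G' : G.Subgraph | Nonempty (G'.coe ≃g H) }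

end GraphDefs

/-- The number of cherries (paths with two edges) of a bipartite graph with
parts `Fin n` and `Fin n`, whose edge set is given as a set `S` of pairs:
unordered pairs of distinct edges sharing an endpoint. -/
noncomputable def cherryCount {n : ℕ} (S : Finset (Fin n × Fin n)) : ℕ :=
  Set.ncard { q : Sym2 (Fin n × Fin n) | ∃ e e' : Fin n × Fin n,
    q = s(e, e') ∧ e ∈ S ∧ e' ∈ S ∧ e ≠ e' ∧ (e.1 = e'.1 ∨ e.2 = e'.2) }

open WCGame

namespace WCProof

def pick {n : ℕ} (h : Hist (Fin n × Fin n)) : Finset (Fin n × Fin n) :=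
  (h.map Prod.snd).toFinset

def rdeg {n : ℕ} (S : Finset (Fin n × Fin n)) (a : Fin n) : ℕ := (S.filter (fun x => x.1 = a)).card
def cdeg {n : ℕ} (S : Finset (Fin n × Fin n)) (a : Fin n) : ℕ := (S.filter (fun x => x.2 = a)).card

def Good {n : ℕ} (b d : ℕ) (h : Hist (Fin n × Fin n)) (O : Finset (Fin n × Fin n)) : Prop :=
  O.card = b ∧ Disjoint O (offeredSet h) ∧ ∀ e ∈ O, rdeg (pick h) e.1 < d ∧ cdeg (pick h) e.2 < d

structure Inv {n : ℕ} (b d : ℕ) (h : Hist (Fin n × Fin n)) : Prop where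
  off : (offeredSet h).card ≤ h.length * b
  crd : (pick h).card = h.length
  sub : pick h ⊆ offeredSet h
  row : ∀ a, rdeg (pick h) a ≤ d
  col : ∀ a, cdeg (pick h) a ≤ d

open Classical in
noncomputable def strat {n : ℕ} (b d m : ℕ) : WaiterStrategy (Fin n × Fin n) := fun h =>
  if hh : h.length < m ∧ ∃ O, Good b d h O then some hh.2.choose else none

theorem strat_good {n b d m : ℕ} {h : Hist (Fin n × Fin n)} {O} (e : strat b d m h = some O) :
    h.length < m ∧ Good b d h O := by
  unfold strat at e
  split_ifs at e with hh
  have := hh.2.choose_spec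
  simp only [Option.some.injEq] at e
  rw [e] at this
  exact ⟨hh.1, this⟩

theorem offered_append {n : ℕ} (h : Hist (Fin n × Fin n)) (O e) :
    offeredSet (h ++ [(O, e)]) = offeredSet h ∪ O := by
  induction h with
  | nil => simp [offeredSet]
  | cons a t ih =>
    simp only [offeredSet, List.cons_append, List.foldr_cons] at ih ⊢
    rw [ih, Finset.union_assoc]

theorem pick_append {n : ℕ} (h : Hist (Fin n × Fin n)) (O e) :
    pick (h ++ [(O, e)]) = insert e (pick h) := by
  ext x; simp [pick]

theorem rows_bad {n d : ℕ} (S : Finset (Fin n × Fin n)) :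
    d * (Finset.univ.filter (fun a => d ≤ rdeg S a)).card ≤ S.card := by
  have := Finset.card_eq_sum_card_fiberwise (f := Prod.fst) (s := S) (t := Finset.univ) (by simp)
  rw [this, mul_comm, ← smul_eq_mul]
  calc _ ≤ ∑ a ∈ Finset.univ.filter (fun a => d ≤ rdeg S a), rdeg S a :=
        Finset.card_nsmul_le_sum _ _ _ (by simp)
    _ ≤ _ := Finset.sum_le_sum_of_subset (Finset.filter_subset _ _)

theorem cols_bad {n d : ℕ} (S : Finset (Fin n × Fin n)) :
    d * (Finset.univ.filter (fun a => d ≤ cdeg S a)).card ≤ S.card := by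
  have := Finset.card_eq_sum_card_fiberwise (f := Prod.snd) (s := S) (t := Finset.univ) (by simp)
  rw [this, mul_comm, ← smul_eq_mul]
  calc _ ≤ ∑ a ∈ Finset.univ.filter (fun a => d ≤ cdeg S a), cdeg S a :=
        Finset.card_nsmul_le_sum _ _ _ (by simp)
    _ ≤ _ := Finset.sum_le_sum_of_subset (Finset.filter_subset _ _)

theorem exists_good {n b d : ℕ} {h : Hist (Fin n × Fin n)} (hI : Inv b d h)
    (hb : 8 * b < n ^ 2) (hd : n ≤ 4 * b * d) (hk : 16 * b * h.length < n ^ 2) :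
    ∃ O, Good b d h O := by
  classical
  set k := h.length
  set R := Finset.univ.filter (fun a => d ≤ rdeg (pick h) a)
  set T := Finset.univ.filter (fun a => d ≤ cdeg (pick h) a)
  have hR : d * R.card ≤ k := (rows_bad (pick h)).trans hI.crd.le
  have hT : d * T.card ≤ k := (cols_bad (pick h)).trans hI.crd.le
  set A := (Finset.univ : Finset (Fin n × Fin n)).filter
    (fun e => e ∉ offeredSet h ∧ rdeg (pick h) e.1 < d ∧ cdeg (pick h) e.2 < d)
  have hcov : (Finset.univ : Finset (Fin n × Fin n)) ⊆
      A ∪ offeredSet h ∪ R ×ˢ Finset.univ ∪ Finset.univ ×ˢ T := by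
    intro e _
    simp only [A, R, T, Finset.mem_union, Finset.mem_filter, Finset.mem_univ, true_and,
      Finset.mem_product, and_true]
    by_cases h1 : e ∈ offeredSet h
    · simp [h1]
    · simp only [h1]
      have := lt_or_ge (rdeg (pick h) e.1) d
      have := lt_or_ge (cdeg (pick h) e.2) d
      tauto
  have hc := Finset.card_le_card hcov
  have h1 := Finset.card_union_le (A ∪ offeredSet h ∪ R ×ˢ Finset.univ) (Finset.univ ×ˢ T)
  have h2 := Finset.card_union_le (A ∪ offeredSet h) (R ×ˢ (Finset.univ : Finset (Fin n)))
  have h3 := Finset.card_union_le A (offeredSet h)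
  have h4 := hI.off
  simp only [Finset.card_product, Finset.card_univ, Fintype.card_prod, Fintype.card_fin] at hc h1 h2
  have key : ∀ r, d * r ≤ k → r * n ≤ 4 * b * k := fun r hr => by
    calc r * n ≤ r * (4 * b * d) := by gcongr
      _ = 4 * b * (d * r) := by ring
      _ ≤ _ := by gcongr
  have h5 := key _ hR
  have h6 := key _ hT
  have hA : b ≤ A.card := by
    rw [mul_comm n T.card] at h1
    change _ ≤ k * b at h4
    nlinarith
  obtain ⟨O, hO, hOc⟩ := Finset.exists_subset_card_eq hA
  refine ⟨O, hOc, ?_, fun e he => ?_⟩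
  · rw [Finset.disjoint_left]
    intro e he
    exact (Finset.mem_filter.1 (hO he)).2.1
  · exact (Finset.mem_filter.1 (hO he)).2.2

theorem inv_step {n b d : ℕ} {h : Hist (Fin n × Fin n)} (hI : Inv b d h) {O e} (hO : Good b d h O)
    (he : e ∈ O) : Inv b d (h ++ [(O, e)]) := by
  obtain ⟨h1, h2, h3⟩ := hO
  have hne : e ∉ pick h := fun hh => Finset.disjoint_left.1 h2 he (hI.sub hh)
  constructor
  · rw [offered_append]
    have := Finset.card_union_le (offeredSet h) O
    have := hI.off
    simp only [List.length_append, List.length_singleton, add_mul, one_mul]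
    omega
  · rw [pick_append, Finset.card_insert_of_notMem hne, hI.crd]; simp
  · rw [pick_append, offered_append]
    intro x hx
    rcases Finset.mem_insert.1 hx with rfl | hx
    · exact Finset.mem_union_right _ he
    · exact Finset.mem_union_left _ (hI.sub hx)
  · intro a
    have := (h3 e he).1
    have h5 := hI.row a
    rw [pick_append]
    unfold rdeg at *
    rw [Finset.filter_insert]
    split_ifs with hh
    · subst hh
      have := Finset.card_insert_le e ((pick h).filter (fun x => x.1 = e.1))
      omega
    · exact h5
  · intro a
    have := (h3 e he).2
    have h5 := hI.col a
    rw [pick_append]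
    unfold cdeg at *
    rw [Finset.filter_insert]
    split_ifs with hh
    · subst hh
      have := Finset.card_insert_le e ((pick h).filter (fun x => x.2 = e.2))
      omega
    · exact h5

theorem play_inv {n b d m : ℕ} (hb1 : 1 ≤ b) (hb : 8 * b < n ^ 2) (hd : n ≤ 4 * b * d)
    (hm : ∀ k, k < m → 16 * b * k < n ^ 2) (C : ClientStrategy (Fin n × Fin n))
    (hC : ClientLegal C) (fuel : ℕ) : ∀ h : Hist (Fin n × Fin n), Inv b d h → h.length ≤ m →
      m ≤ h.length + fuel →
      Inv b d (playAux (strat b d m) C fuel h) ∧ (playAux (strat b d m) C fuel h).length = m := by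
  induction fuel with
  | zero => intro h hI h1 h2; exact ⟨hI, by simp [playAux]; omega⟩
  | succ f ih =>
    intro h hI h1 h2
    cases hs : strat b d m h with
    | none =>
      simp only [playAux, hs]
      refine ⟨hI, ?_⟩
      by_contra hne
      have hlt : h.length < m := by omega
      have hex := exists_good hI hb hd (hm _ hlt)
      simp [strat, hlt, hex] at hs
    | some O =>
      simp only [playAux, hs]
      obtain ⟨hlt, hg⟩ := strat_good hs
      have hne : O.Nonempty := by
        rw [← Finset.card_pos, hg.1]; omega
      exact ih _ (inv_step hI hg (hC h O hne)) (by simp; omega) (by simp; omega)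

theorem cherry_le {n d : ℕ} (S : Finset (Fin n × Fin n)) (hr : ∀ a, rdeg S a ≤ d)
    (hc : ∀ a, cdeg S a ≤ d) : cherryCount S ≤ S.card * (2 * (d - 1)) := by
  classical
  set N : Fin n × Fin n → Finset (Fin n × Fin n) := fun e =>
    (S.filter (fun x => x.1 = e.1)).erase e ∪ (S.filter (fun x => x.2 = e.2)).erase e
  have hN : ∀ e ∈ S, (N e).card ≤ 2 * (d - 1) := by
    intro e he
    have h0 := Finset.card_union_le ((S.filter (fun x => x.1 = e.1)).erase e)
      ((S.filter (fun x => x.2 = e.2)).erase e)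
    rw [Finset.card_erase_of_mem (by simp [he]), Finset.card_erase_of_mem (by simp [he])] at h0
    have h1 := hr e.1
    have h2 := hc e.2
    unfold rdeg at h1
    unfold cdeg at h2
    simp only [N]
    omega
  have hsub : { q : Sym2 (Fin n × Fin n) | ∃ e e' : Fin n × Fin n,
    q = s(e, e') ∧ e ∈ S ∧ e' ∈ S ∧ e ≠ e' ∧ (e.1 = e'.1 ∨ e.2 = e'.2) } ⊆
      ((S.biUnion (fun e => (N e).image (fun e' => s(e, e'))) : Finset (Sym2 (Fin n × Fin n))) :
        Set (Sym2 (Fin n × Fin n))) := by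
    rintro q ⟨e, e', rfl, h1, h2, h3, h4⟩
    simp only [Finset.coe_biUnion, Set.mem_iUnion, Finset.mem_coe, Finset.mem_image]
    refine ⟨e, h1, e', ?_, rfl⟩
    simp only [N, Finset.mem_union, Finset.mem_erase, Finset.mem_filter]
    rcases h4 with h4 | h4
    · exact Or.inl ⟨h3.symm, h2, h4.symm⟩
    · exact Or.inr ⟨h3.symm, h2, h4.symm⟩
  unfold cherryCount
  refine (Set.ncard_le_ncard hsub (Finset.finite_toSet _)).trans ?_
  rw [Set.ncard_coe_finset]
  exact Finset.card_biUnion_le_card_mul _ _ _ fun e he => Finset.card_image_le.trans (hN e he)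

end WCProof

open Filter WCGame in
/-- base case: on the complete bipartite graph with parts of size
`n` (edges encoded as pairs in `Fin n × Fin n`), for large `n` and `1 ≤ b < n²/8`,
Waiter can ensure: at least `n²p/16` edges, at most `2n²p` edges, and at most
`2n³p²` cherries, where `p = 1/b`. -/
theorem waiter_client_base_case :
    ∀ᶠ n : ℕ in atTop, ∀ b : ℕ, 1 ≤ b → (b : ℝ) < (n : ℝ) ^ 2 / 8 →
      WaiterCanEnsure (Finset.univ : Finset (Fin n × Fin n)) b
        (fun S =>
          let p : ℝ := 1 / b
          (n : ℝ) ^ 2 * p / 16 ≤ (S.card : ℝ) ∧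
          (S.card : ℝ) ≤ 2 * (n : ℝ) ^ 2 * p ∧
          (cherryCount S : ℝ) ≤ 2 * (n : ℝ) ^ 3 * p ^ 2) := by
  refine Filter.Eventually.of_forall fun n b hb1 hbn => ?_
  have hb8 : 8 * b < n ^ 2 := by
    have : (8 * b : ℝ) < n ^ 2 := by linarith
    exact_mod_cast this
  have hb0 : (0 : ℝ) < b := by exact_mod_cast hb1
  have hb1' : (1 : ℝ) ≤ b := by exact_mod_cast hb1
  set d := ⌈(n : ℝ) / (4 * b)⌉₊ with hd
  set m := ⌈(n : ℝ) ^ 2 / (16 * b)⌉₊ with hm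
  have hd1 : n ≤ 4 * b * d := by
    have := Nat.le_ceil ((n : ℝ) / (4 * b))
    rw [← hd, div_le_iff₀ (by positivity)] at this
    have h2 : (n : ℝ) ≤ 4 * b * d := by linarith
    exact_mod_cast h2
  have hm1 : ∀ k, k < m → 16 * b * k < n ^ 2 := by
    intro k hk
    rw [hm, Nat.lt_ceil, lt_div_iff₀ (by positivity)] at hk
    have h2 : (16 * b * k : ℝ) < n ^ 2 := by linarith
    exact_mod_cast h2
  have hmle : (n : ℝ) ^ 2 / (16 * b) ≤ m := Nat.le_ceil _
  have hmlt : (m : ℝ) < (n : ℝ) ^ 2 / (16 * b) + 1 := Nat.ceil_lt_add_one (by positivity)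
  have hmn : m ≤ n ^ 2 := by
    rw [hm, Nat.ceil_le]
    push_cast
    exact div_le_self (by positivity) (by linarith)
  refine ⟨WCProof.strat b d m, ?_, fun C hC => ?_⟩
  · intro h O hO
    have := (WCProof.strat_good hO).2
    exact ⟨this.1, Finset.subset_univ _, this.2.1⟩
  have hI0 : WCProof.Inv (n := n) b d [] := by
    constructor <;> simp [offeredSet, WCProof.pick, WCProof.rdeg, WCProof.cdeg]
  obtain ⟨hI, hlen⟩ := WCProof.play_inv hb1 hb8 hd1 hm1 C hC
    (Finset.univ : Finset (Fin n × Fin n)).card [] hI0 (by simp) (by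
      simp only [List.length_nil, Finset.card_univ, Fintype.card_prod, Fintype.card_fin]
      nlinarith)
  set S := finalSet (Finset.univ : Finset (Fin n × Fin n)) (WCProof.strat b d m) C with hS
  have hcard : S.card = m := by rw [← hlen, ← hI.crd]; rfl
  have hch : cherryCount S ≤ m * (2 * (d - 1)) := by
    rw [← hcard]
    exact WCProof.cherry_le S hI.row hI.col
  have hdlt : ((d - 1 : ℕ) : ℝ) ≤ (n : ℝ) / (4 * b) := by
    have : (d : ℝ) < (n : ℝ) / (4 * b) + 1 := Nat.ceil_lt_add_one (by positivity)
    rcases Nat.eq_zero_or_pos d with h | h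
    · rw [h]; simp; positivity
    · rw [Nat.cast_sub h]; push_cast; linarith
  set t : ℝ := (n : ℝ) ^ 2 / b with ht
  have ht8 : 8 < t := by rw [ht, lt_div_iff₀ hb0]; linarith
  have ht16 : (n : ℝ) ^ 2 / (16 * b) = t / 16 := by rw [ht]; field_simp
  rw [ht16] at hmle hmlt
  refine ⟨?_, ?_, ?_⟩
  · rw [hcard]
    calc _ = t / 16 := by rw [ht]; ring
      _ ≤ _ := hmle
  · rw [hcard]
    calc (m : ℝ) ≤ 2 * t := by linarith
      _ = _ := by rw [ht]; ring
  · have h1 : (cherryCount S : ℝ) ≤ m * (2 * ((d - 1 : ℕ) : ℝ)) := by exact_mod_cast hch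
    calc (cherryCount S : ℝ) ≤ m * (2 * ((d - 1 : ℕ) : ℝ)) := h1
      _ ≤ (2 * t) * (2 * ((n : ℝ) / (4 * b))) := by
        gcongr
        linarith
      _ = 1 * ((n : ℝ) ^ 3 * (1 / b) ^ 2) := by rw [ht]; ring
      _ ≤ 2 * ((n : ℝ) ^ 3 * (1 / b) ^ 2) := by gcongr; norm_num
      _ = _ := by ring
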